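/- arXiv:1311.1245 — 7 statements merged into one kernel-verified Lean document; each statement's English description precedes it below -/
import Mathlib

section
/- For every real number α > 0 there exists a constant c > 0 such that for all real numbers z and η one has (1+η²)^{1/4} · Q(z,η)^{1/4} / √(α²+z²) ≥ c, where Q(z,η) := (α² − z² + η²)² + 4α²z². In other words, for fixed α > 0 the quantity (1+η²)^{1/4}|S(z,η)| is bounded from below by a positive constant, uniformly in z and η. -/
/-- For every `α > 0` there is `c > 0` with
`(1+η²)^{1/4} · Q(z,η)^{1/4} / √(α²+z²) ≥ c` for all real `z, η`,
where `Q(z,η) = (α² − z² + η²)² + 4α²z²`. -/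
theorem multiplier_lower_bound (α : ℝ) (hα : 0 < α) :
    ∃ c : ℝ, 0 < c ∧ ∀ z η : ℝ,
      c ≤ (1 + η ^ 2) ^ ((1 : ℝ) / 4) *
            (((α ^ 2 - z ^ 2 + η ^ 2) ^ 2 + 4 * α ^ 2 * z ^ 2) ^ ((1 : ℝ) / 4)) /
            Real.sqrt (α ^ 2 + z ^ 2) := by
  have hk : 0 < min (1 / 4 : ℝ) (α ^ 2) := lt_min (by norm_num) (by positivity)
  refine ⟨(min (1 / 4 : ℝ) (α ^ 2)) ^ ((1 : ℝ) / 4), Real.rpow_pos_of_pos hk _, ?_⟩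
  intro z η
  have hs : 0 < α ^ 2 + z ^ 2 := by positivity
  have hsq : Real.sqrt (α ^ 2 + z ^ 2) = ((α ^ 2 + z ^ 2) ^ 2) ^ ((1 : ℝ) / 4) := by
    rw [Real.sqrt_eq_rpow, ← Real.rpow_natCast (α ^ 2 + z ^ 2) 2, ← Real.rpow_mul hs.le]
    norm_num
  rw [le_div_iff₀ (Real.sqrt_pos.mpr hs), hsq, ← Real.mul_rpow hk.le (by positivity),
    ← Real.mul_rpow (by positivity) (by positivity)]
  apply Real.rpow_le_rpow (by positivity) _ (by norm_num)
  have hQ : (α ^ 2 - z ^ 2 + η ^ 2) ^ 2 + 4 * α ^ 2 * z ^ 2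
      = (α ^ 2 + z ^ 2 - η ^ 2) ^ 2 + 4 * α ^ 2 * η ^ 2 := by ring
  rw [hQ]
  have ha : 0 < α ^ 2 := by positivity
  have he : 0 ≤ η ^ 2 := by positivity
  generalize α ^ 2 + z ^ 2 = s at *
  generalize η ^ 2 = e at *
  generalize α ^ 2 = a at *
  rcases le_total e (s / 2) with h | h
  · calc min (1 / 4) a * s ^ 2 ≤ 1 / 4 * s ^ 2 := by gcongr; exact min_le_left _ _
      _ ≤ (s - e) ^ 2 + 4 * a * e := by
        have : 0 ≤ a * e := by positivity
        nlinarith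
      _ ≤ _ := le_mul_of_one_le_left (by positivity) (by linarith)
  · calc min (1 / 4) a * s ^ 2 ≤ a * s ^ 2 := by gcongr; exact min_le_right _ _
      _ ≤ a * (2 * e) ^ 2 := by gcongr; linarith
      _ = e * (0 + 4 * a * e) := by ring
      _ ≤ _ := by gcongr <;> first | positivity | linarith
end

section
/- For every real number α > 0 there exists a constant c > 0 such that for all real numbers z and η one has (1+η²)^{1/4} · Q(z,η)^{1/4} / √(α²+z²) ≥ c · [ (1+η²) / ( (1+η²)(1+α²) + 1 ) ]^{1/4}, where Q(z,η) := (α² − z² + η²)² + 4α²z². -/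
/-- For every `α > 0` there is `c > 0` with
`(1+η²)^{1/4} · Q(z,η)^{1/4} / √(α²+z²) ≥ c · ((1+η²)/((1+η²)(1+α²)+1))^{1/4}`
for all real `z, η`, where `Q(z,η) = (α² − z² + η²)² + 4α²z²`. -/
theorem multiplier_explicit_lower_bound (α : ℝ) (hα : 0 < α) :
    ∃ c : ℝ, 0 < c ∧ ∀ z η : ℝ,
      c * ((1 + η ^ 2) / ((1 + η ^ 2) * (1 + α ^ 2) + 1)) ^ ((1 : ℝ) / 4) ≤
        (1 + η ^ 2) ^ ((1 : ℝ) / 4) *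
          (((α ^ 2 - z ^ 2 + η ^ 2) ^ 2 + 4 * α ^ 2 * z ^ 2) ^ ((1 : ℝ) / 4)) /
          Real.sqrt (α ^ 2 + z ^ 2) := by
  have ha : 0 < α ^ 2 := by positivity
  refine ⟨(4 * α ^ 2 / (1 + 4 * α ^ 2)) ^ ((1 : ℝ) / 4), by positivity, fun z η => ?_⟩
  have hs : 0 ≤ z ^ 2 := sq_nonneg z
  have ht : 0 ≤ η ^ 2 := sq_nonneg η
  have hu : 0 < α ^ 2 + z ^ 2 := by positivity
  have hQ : (α ^ 2 - z ^ 2 + η ^ 2) ^ 2 + 4 * α ^ 2 * z ^ 2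
      = (α ^ 2 + z ^ 2 - η ^ 2) ^ 2 + 4 * α ^ 2 * η ^ 2 := by ring
  have hsq : Real.sqrt (α ^ 2 + z ^ 2) = ((α ^ 2 + z ^ 2) ^ 2) ^ ((1 : ℝ) / 4) := by
    rw [Real.sqrt_eq_rpow, ← Real.rpow_natCast (α ^ 2 + z ^ 2) 2, ← Real.rpow_mul hu.le]
    norm_num
  rw [hsq, hQ]
  generalize α ^ 2 = a at *
  generalize z ^ 2 = s at *
  generalize η ^ 2 = t at *
  rw [← Real.mul_rpow (by positivity) (by positivity),
    ← Real.mul_rpow (by positivity) (by positivity),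
    ← Real.div_rpow (by positivity) (by positivity)]
  apply Real.rpow_le_rpow (by positivity) _ (by norm_num)
  have key : 4 * a * (a + s) ^ 2 ≤
      ((a + s - t) ^ 2 + 4 * a * t) * ((1 + t) * (1 + a) + 1) * (1 + 4 * a) := by
    have h1 : 4 * a * (a + s) ^ 2 ≤ ((a + s - t) ^ 2 + 4 * a * t ^ 2) * (1 + 4 * a) := by
      nlinarith [sq_nonneg ((a + s - t) - 4 * a * t)]
    refine h1.trans (mul_le_mul_of_nonneg_right ?_ (by positivity))
    have h2 : (a + s - t) ^ 2 + 4 * a * t ^ 2 ≤ ((a + s - t) ^ 2 + 4 * a * t) * (1 + t) := by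
      have : 0 ≤ (a + s - t) ^ 2 * t := by positivity
      have : 0 ≤ a * t := by positivity
      nlinarith
    refine h2.trans (mul_le_mul_of_nonneg_left ?_ (by positivity))
    nlinarith [mul_nonneg ht ha.le]
  rw [div_mul_div_comm, div_le_div_iff₀ (by positivity) (by positivity)]
  calc _ = (1 + t) * (4 * a * (a + s) ^ 2) := by ring
    _ ≤ (1 + t) * _ := mul_le_mul_of_nonneg_left key (by positivity)
    _ = _ := by ring
end

section
/- For every real number α > 0 there exists a constant C > 0 such that for all real numbers z and η one has M(z,η) ≤ C · [ 1 + α² + 1/(1+η²) ]^{1/4}, where M(z,η) := (1+η²)^{−1/4} · √(α²+z²) / Q(z,η)^{1/4} and Q(z,η) := (α² − z² + η²)² + 4α²z². -/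
/-- For every `α > 0` there is `C > 0` with
`M(z,η) ≤ C · (1 + α² + 1/(1+η²))^{1/4}` for all real `z, η`, where
`M(z,η) = (1+η²)^{−1/4} √(α²+z²) / Q(z,η)^{1/4}` and
`Q(z,η) = (α² − z² + η²)² + 4α²z²`. -/
theorem multiplier_upper_bound (α : ℝ) (hα : 0 < α) :
    ∃ C : ℝ, 0 < C ∧ ∀ z η : ℝ,
      (1 + η ^ 2) ^ (-((1 : ℝ) / 4)) * Real.sqrt (α ^ 2 + z ^ 2) /
          (((α ^ 2 - z ^ 2 + η ^ 2) ^ 2 + 4 * α ^ 2 * z ^ 2) ^ ((1 : ℝ) / 4)) ≤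
        C * (1 + α ^ 2 + 1 / (1 + η ^ 2)) ^ ((1 : ℝ) / 4) := by
  have hK : (0 : ℝ) < 2 + 1 / (2 * α ^ 2) := by positivity
  refine ⟨(2 + 1 / (2 * α ^ 2)) ^ ((1 : ℝ) / 4), by positivity, fun z η => ?_⟩
  set K : ℝ := 2 + 1 / (2 * α ^ 2) with hKdef
  have hKa : K * (4 * α ^ 2) = 8 * α ^ 2 + 2 := by
    rw [hKdef]; field_simp; ring
  have hK2 : 2 ≤ K := by
    have : 0 < 1 / (2 * α ^ 2) := by positivity
    linarith
  set Q : ℝ := (α ^ 2 - z ^ 2 + η ^ 2) ^ 2 + 4 * α ^ 2 * z ^ 2 with hQ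
  have hQ' : Q = (α ^ 2 + z ^ 2 - η ^ 2) ^ 2 + 4 * α ^ 2 * η ^ 2 := by rw [hQ]; ring
  have hQpos : 0 < Q := by
    rcases eq_or_ne z 0 with h | h
    · have h0 : 0 < α ^ 2 + η ^ 2 := by positivity
      have h1 : Q = (α ^ 2 + η ^ 2) ^ 2 := by rw [hQ, h]; ring
      rw [h1]; positivity
    · rw [hQ]; positivity
  have hs : 0 < α ^ 2 + z ^ 2 := by positivity
  have hy : 0 < 1 + η ^ 2 := by positivity
  have key : (α ^ 2 + z ^ 2) ^ 2 ≤ K * ((1 + η ^ 2) * Q) := by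
    have e : K * ((1 + η ^ 2) * Q) = K * (1 + η ^ 2) * (α ^ 2 + z ^ 2 - η ^ 2) ^ 2
        + (8 * α ^ 2 + 2) * ((1 + η ^ 2) * η ^ 2) := by
      rw [hQ', ← hKa]; ring
    have h1 : 2 * (α ^ 2 + z ^ 2 - η ^ 2) ^ 2
        ≤ K * (1 + η ^ 2) * (α ^ 2 + z ^ 2 - η ^ 2) ^ 2 := by
      apply mul_le_mul_of_nonneg_right _ (sq_nonneg _)
      nlinarith [sq_nonneg η]
    have h2 : 2 * (η ^ 2) ^ 2 ≤ (8 * α ^ 2 + 2) * ((1 + η ^ 2) * η ^ 2) := by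
      have : 0 ≤ 8 * α ^ 2 * ((1 + η ^ 2) * η ^ 2) + 2 * η ^ 2 := by positivity
      linarith
    rw [e]
    linarith [sq_nonneg (α ^ 2 + z ^ 2 - η ^ 2 - η ^ 2)]
  have hsq : Real.sqrt (α ^ 2 + z ^ 2) = ((α ^ 2 + z ^ 2) ^ 2) ^ ((1 : ℝ) / 4) := by
    rw [Real.sqrt_eq_rpow, ← Real.rpow_natCast (α ^ 2 + z ^ 2) 2, ← Real.rpow_mul hs.le]
    norm_num
  have hone : 1 ≤ (1 + α ^ 2 + 1 / (1 + η ^ 2)) ^ ((1 : ℝ) / 4) := by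
    apply Real.one_le_rpow _ (by norm_num)
    have : 0 < α ^ 2 + 1 / (1 + η ^ 2) := by positivity
    linarith
  have hmain := Real.rpow_le_rpow (by positivity) key (by norm_num : (0 : ℝ) ≤ 1 / 4)
  rw [Real.mul_rpow hK.le (by positivity), Real.mul_rpow hy.le hQpos.le, ← hsq] at hmain
  have hyp := Real.rpow_pos_of_pos hy ((1 : ℝ) / 4)
  have hQp := Real.rpow_pos_of_pos hQpos ((1 : ℝ) / 4)
  have hKp := Real.rpow_pos_of_pos hK ((1 : ℝ) / 4)
  refine le_trans ?_ (le_mul_of_one_le_right hKp.le hone)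
  rw [Real.rpow_neg hy.le, div_le_iff₀ hQp, inv_mul_le_iff₀ hyp]
  linarith
end

section
/- Let α > 0 and let z, η be real numbers with 2|z| < |η| (Case A of the multiplier analysis). Then M(z,η) ≤ ( 2/(1+η²) )^{1/4}, where M(z,η) := (1+η²)^{−1/4} · √(α²+z²) / Q(z,η)^{1/4} and Q(z,η) := (α² − z² + η²)² + 4α²z². -/
/-- Case A (`2|z| < |η|`): `M(z,η) ≤ (2/(1+η²))^{1/4}`, where
`M(z,η) = (1+η²)^{−1/4} √(α²+z²) / Q(z,η)^{1/4}` and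
`Q(z,η) = (α² − z² + η²)² + 4α²z²`. -/
theorem multiplier_caseA (α z η : ℝ) (hα : 0 < α) (h : 2 * |z| < |η|) :
    (1 + η ^ 2) ^ (-((1 : ℝ) / 4)) * Real.sqrt (α ^ 2 + z ^ 2) /
        (((α ^ 2 - z ^ 2 + η ^ 2) ^ 2 + 4 * α ^ 2 * z ^ 2) ^ ((1 : ℝ) / 4)) ≤
      (2 / (1 + η ^ 2)) ^ ((1 : ℝ) / 4) := by
  have hz : 4 * z ^ 2 ≤ η ^ 2 := by
    have h1 : (2 * |z|) ^ 2 ≤ |η| ^ 2 := by gcongr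
    rw [mul_pow, sq_abs, sq_abs] at h1
    linarith
  have hA : 0 < α ^ 2 + z ^ 2 := by positivity
  have hle : α ^ 2 + z ^ 2 ≤ α ^ 2 - z ^ 2 + η ^ 2 := by nlinarith [sq_nonneg z]
  have hQ : (α ^ 2 + z ^ 2) ^ 2 ≤ (α ^ 2 - z ^ 2 + η ^ 2) ^ 2 + 4 * α ^ 2 * z ^ 2 := by
    have h1 : (α ^ 2 + z ^ 2) ^ 2 ≤ (α ^ 2 - z ^ 2 + η ^ 2) ^ 2 := by gcongr
    have h2 : 0 ≤ 4 * α ^ 2 * z ^ 2 := by positivity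
    linarith
  have hQpos : 0 < (α ^ 2 - z ^ 2 + η ^ 2) ^ 2 + 4 * α ^ 2 * z ^ 2 :=
    lt_of_lt_of_le (by positivity) hQ
  have hs : Real.sqrt (α ^ 2 + z ^ 2) = ((α ^ 2 + z ^ 2) ^ 2) ^ ((1 : ℝ) / 4) := by
    rw [Real.sqrt_eq_rpow, ← Real.rpow_natCast (α ^ 2 + z ^ 2) 2, ← Real.rpow_mul hA.le]
    norm_num
  have hd : Real.sqrt (α ^ 2 + z ^ 2) /
      (((α ^ 2 - z ^ 2 + η ^ 2) ^ 2 + 4 * α ^ 2 * z ^ 2) ^ ((1 : ℝ) / 4)) ≤ 1 := by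
    rw [div_le_one (Real.rpow_pos_of_pos hQpos _), hs]
    exact Real.rpow_le_rpow (by positivity) hQ (by norm_num)
  have h2 : (1 : ℝ) ≤ 2 ^ ((1 : ℝ) / 4) := Real.one_le_rpow (by norm_num) (by norm_num)
  have hη : (0 : ℝ) < 1 + η ^ 2 := by positivity
  rw [Real.div_rpow (by norm_num) hη.le, mul_div_assoc, Real.rpow_neg hη.le, div_eq_inv_mul (2 ^ ((1 : ℝ) / 4)) ((1 + η ^ 2) ^ ((1 : ℝ) / 4))]
  exact mul_le_mul_of_nonneg_left (hd.trans h2) (by positivity)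
end

section
/- Let α > 0 and let z, η be real numbers with |z| > 2|η| (Case C of the multiplier analysis). Then M(z,η) ≤ ( 81/(1+η²) )^{1/4}, where M(z,η) := (1+η²)^{−1/4} · √(α²+z²) / Q(z,η)^{1/4} and Q(z,η) := (α² − z² + η²)² + 4α²z². -/
/-- Case C (`|z| > 2|η|`): `M(z,η) ≤ (81/(1+η²))^{1/4}`, where
`M(z,η) = (1+η²)^{−1/4} √(α²+z²) / Q(z,η)^{1/4}` and
`Q(z,η) = (α² − z² + η²)² + 4α²z²`. -/
theorem multiplier_caseC (α z η : ℝ) (hα : 0 < α) (h : 2 * |η| < |z|) :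
    (1 + η ^ 2) ^ (-((1 : ℝ) / 4)) * Real.sqrt (α ^ 2 + z ^ 2) /
        (((α ^ 2 - z ^ 2 + η ^ 2) ^ 2 + 4 * α ^ 2 * z ^ 2) ^ ((1 : ℝ) / 4)) ≤
      (81 / (1 + η ^ 2)) ^ ((1 : ℝ) / 4) := by
  have he : 4 * η ^ 2 ≤ z ^ 2 := by
    rw [← sq_abs η, ← sq_abs z]
    nlinarith [abs_nonneg η, abs_nonneg z]
  have ha : 0 < α ^ 2 := by positivity
  have hs : 0 ≤ z ^ 2 := sq_nonneg z
  have hn : 0 ≤ η ^ 2 := sq_nonneg η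
  generalize α ^ 2 = a at *
  generalize z ^ 2 = s at *
  generalize η ^ 2 = e at *
  have hQ : (a + s) ^ 2 ≤ 81 * ((a - s + e) ^ 2 + 4 * a * s) := by
    nlinarith [mul_nonneg hn ha.le, mul_nonneg hs ha.le, mul_nonneg hs (sub_nonneg.2 he),
      sq_nonneg e, sq_nonneg a, sq_nonneg s]
  have hpos : 0 < (a - s + e) ^ 2 + 4 * a * s := by
    have : 0 < (a + s) ^ 2 := by positivity
    linarith
  generalize (a - s + e) ^ 2 + 4 * a * s = Q at *
  have hsq : Real.sqrt (a + s) = ((a + s) ^ 2) ^ ((1 : ℝ) / 4) := by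
    rw [Real.sqrt_eq_rpow, ← Real.rpow_natCast, ← Real.rpow_mul (by positivity)]
    norm_num
  have h1 : 0 < 1 + e := by positivity
  rw [hsq, Real.rpow_neg h1.le, ← Real.inv_rpow h1.le,
    ← Real.mul_rpow (by positivity) (by positivity),
    ← Real.div_rpow (by positivity) hpos.le]
  apply Real.rpow_le_rpow (by positivity) _ (by norm_num)
  rw [div_le_iff₀ hpos, div_eq_inv_mul, mul_assoc]
  exact mul_le_mul_of_nonneg_left hQ (by positivity)
end

section
/- Let α > 0 and let z, η be real numbers with |η|/2 ≤ |z| ≤ 2|η| (Case B of the multiplier analysis). Then M(z,η) ≤ (1+η²)^{−1/4} · √(α² + 4η²) / ( (5/2)α²η² + α⁴ )^{1/4}, where M(z,η) := (1+η²)^{−1/4} · √(α²+z²) / Q(z,η)^{1/4} and Q(z,η) := (α² − z² + η²)² + 4α²z². -/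
/-- Case B (`|η|/2 ≤ |z| ≤ 2|η|`):
`M(z,η) ≤ (1+η²)^{−1/4} √(α²+4η²) / ((5/2)α²η² + α⁴)^{1/4}`, where
`M(z,η) = (1+η²)^{−1/4} √(α²+z²) / Q(z,η)^{1/4}` and
`Q(z,η) = (α² − z² + η²)² + 4α²z²`. -/
theorem multiplier_caseB (α z η : ℝ) (hα : 0 < α)
    (h1 : |η| / 2 ≤ |z|) (h2 : |z| ≤ 2 * |η|) :
    (1 + η ^ 2) ^ (-((1 : ℝ) / 4)) * Real.sqrt (α ^ 2 + z ^ 2) /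
        (((α ^ 2 - z ^ 2 + η ^ 2) ^ 2 + 4 * α ^ 2 * z ^ 2) ^ ((1 : ℝ) / 4)) ≤
      (1 + η ^ 2) ^ (-((1 : ℝ) / 4)) * Real.sqrt (α ^ 2 + 4 * η ^ 2) /
        ((5 / 2 * α ^ 2 * η ^ 2 + α ^ 4) ^ ((1 : ℝ) / 4)) := by
  have hz1 : η ^ 2 ≤ 4 * z ^ 2 := by
    have h := pow_le_pow_left₀ (by positivity) h1 2
    rw [div_pow, sq_abs, sq_abs] at h
    linarith
  have hz2 : z ^ 2 ≤ 4 * η ^ 2 := by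
    have h := pow_le_pow_left₀ (by positivity) h2 2
    rw [mul_pow, sq_abs, sq_abs] at h
    linarith
  have hQ : 5 / 2 * α ^ 2 * η ^ 2 + α ^ 4 ≤
      (α ^ 2 - z ^ 2 + η ^ 2) ^ 2 + 4 * α ^ 2 * z ^ 2 := by
    have h := mul_le_mul_of_nonneg_left hz1 (sq_nonneg α)
    linarith [sq_nonneg (η ^ 2 - z ^ 2)]
  have hpos : 0 < 5 / 2 * α ^ 2 * η ^ 2 + α ^ 4 := by positivity
  have hs : Real.sqrt (α ^ 2 + z ^ 2) ≤ Real.sqrt (α ^ 2 + 4 * η ^ 2) :=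
    Real.sqrt_le_sqrt (by linarith)
  have hr := Real.rpow_le_rpow hpos.le hQ (by norm_num : (0 : ℝ) ≤ 1 / 4)
  exact div_le_div₀ (by positivity)
    (mul_le_mul_of_nonneg_left hs (by positivity)) (Real.rpow_pos_of_pos hpos _) hr
end

section
/- Let α > 0 and let z, η be real numbers with |η|/2 ≤ |z| ≤ 2|η| (Case B of the multiplier analysis). Then M(z,η)⁴ ≤ 2 + 64/(5α²), where M(z,η) := (1+η²)^{−1/4} · √(α²+z²) / Q(z,η)^{1/4} and Q(z,η) := (α² − z² + η²)² + 4α²z². In particular, for each fixed α > 0 the quantity M is bounded uniformly on the region |η|/2 ≤ |z| ≤ 2|η|. -/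
/-- Case B (`|η|/2 ≤ |z| ≤ 2|η|`), corrected α-explicit bound:
`M(z,η)⁴ ≤ 2 + 64/(5α²)`, where
`M(z,η) = (1+η²)^{−1/4} √(α²+z²) / Q(z,η)^{1/4}` and
`Q(z,η) = (α² − z² + η²)² + 4α²z²`. -/
theorem multiplier_caseB_uniform (α z η : ℝ) (hα : 0 < α)
    (h1 : |η| / 2 ≤ |z|) (h2 : |z| ≤ 2 * |η|) :
    ((1 + η ^ 2) ^ (-((1 : ℝ) / 4)) * Real.sqrt (α ^ 2 + z ^ 2) /
        (((α ^ 2 - z ^ 2 + η ^ 2) ^ 2 + 4 * α ^ 2 * z ^ 2) ^ ((1 : ℝ) / 4))) ^ 4 ≤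
      2 + 64 / (5 * α ^ 2) := by
  have hy : 0 ≤ η ^ 2 := sq_nonneg η
  have hx : 0 ≤ z ^ 2 := sq_nonneg z
  have ha : 0 < α ^ 2 := by positivity
  generalize η ^ 2 = y at *
  generalize z ^ 2 = x at *
  generalize α ^ 2 = a at *
  have hQ : (a - x + y) ^ 2 + 4 * a * x = (a + x - y) ^ 2 + 4 * a * y := by ring
  have hQpos : 0 < (a - x + y) ^ 2 + 4 * a * x := by
    rcases hx.eq_or_lt with h | h
    · have : 0 < a - x + y := by linarith
      positivity
    · positivity
  rw [hQ] at hQpos ⊢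
  have hQ1 : (a + x - y) ^ 2 ≤ (a + x - y) ^ 2 + 4 * a * y := by
    have : 0 ≤ 4 * a * y := by positivity
    linarith
  have hQ2 : 4 * a * y ≤ (a + x - y) ^ 2 + 4 * a * y := by
    linarith [sq_nonneg (a + x - y)]
  generalize (a + x - y) ^ 2 + 4 * a * y = Q at *
  have e1 : ((1 + y) ^ (-((1 : ℝ) / 4))) ^ 4 = (1 + y)⁻¹ := by
    rw [← Real.rpow_natCast, ← Real.rpow_mul (by positivity), ← Real.rpow_neg_one]
    norm_num
  have e2 : (Q ^ ((1 : ℝ) / 4)) ^ 4 = Q := by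
    rw [← Real.rpow_natCast, ← Real.rpow_mul hQpos.le]
    norm_num
  have e3 : Real.sqrt (a + x) ^ 4 = (a + x) ^ 2 := by
    rw [show (4 : ℕ) = 2 * 2 from rfl, pow_mul, Real.sq_sqrt (by positivity)]
  rw [div_pow, mul_pow, e1, e2, e3, div_le_iff₀ hQpos, inv_mul_le_iff₀ (by positivity)]
  have k1 : (a + x) ^ 2 ≤ 2 * (a + x - y) ^ 2 + 2 * y ^ 2 := by
    nlinarith [sq_nonneg (a + x - 2 * y)]
  have k2 : 2 * y ^ 2 ≤ y * (64 / (5 * a) * Q) := by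
    have : 64 / (5 * a) * (4 * a * y) ≤ 64 / (5 * a) * Q :=
      mul_le_mul_of_nonneg_left hQ2 (by positivity)
    have e : 64 / (5 * a) * (4 * a * y) = 256 / 5 * y := by
      field_simp
      ring
    rw [e] at this
    nlinarith [mul_le_mul_of_nonneg_left this hy, sq_nonneg y]
  have k3 : 0 ≤ 64 / (5 * a) * Q := by positivity
  have k4 : 0 ≤ y * Q := by positivity
  linarith
end
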